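/- There exists C > 0 depending only on λ₀, M₀, α₊, α₋ and β such that if τ ≥ 1, τ ≥ λ₂²|ξ|/(2s₀), 0 < s ≤ s₀ ≤ 1/C, and supp v̂±(ξ,·) ⊂ [−c₀/(2β), c₀/β] with c₀ = min(α₋, 1), then Λ Σ± |V±(ξ)|² + Λ³ Σ± |v̂±(ξ,0)|² + Λ⁴ Σ± ‖v̂±(ξ,·)‖²_{L²(ℝ±)} + Λ² Σ± ‖∂_y v̂±(ξ,·)‖²_{L²(ℝ±)} ≤ C Σ± ‖P± v̂±(ξ,·)‖²_{L²(ℝ±)} + C Λ |η₁(ξ)|² + C Λ³ |η₀(ξ)|². -/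

import Mathlib

open MeasureTheory

noncomputable section

/-- `ℝ^m`, the tangential space (here `m = n - 1`). -/
abbrev Em (m : ℕ) : Type := EuclideanSpace ℝ (Fin m)

variable {m : ℕ}

/-- The entry `a_{nn}(y)` of the coefficient matrix. -/
def ann (a : ℝ → Matrix (Fin (m + 1)) (Fin (m + 1)) ℝ) (y : ℝ) : ℝ :=
  a y (Fin.last m) (Fin.last m)

/-- `b_{jk}(y) = a_{jk}(y) - a_{nj}(y) a_{nk}(y) / a_{nn}(y)`. -/
def bcoef (a : ℝ → Matrix (Fin (m + 1)) (Fin (m + 1)) ℝ) (j k : Fin m) (y : ℝ) : ℝ :=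
  a y j.castSucc k.castSucc -
    a y (Fin.last m) j.castSucc * a y (Fin.last m) k.castSucc / ann a y

/-- The quadratic form `B(ξ, η, y) = Σ_{jk} b_{jk}(y) ξ_j η_k`. -/
def Bform (a : ℝ → Matrix (Fin (m + 1)) (Fin (m + 1)) ℝ) (ξ η : Em m) (y : ℝ) : ℝ :=
  ∑ j, ∑ k, bcoef a j k y * ξ j * η k

/-- `t(ξ, y) = Σ_j a_{nj}(y) ξ_j / a_{nn}(y)`. -/
def tform (a : ℝ → Matrix (Fin (m + 1)) (Fin (m + 1)) ℝ) (ξ : Em m) (y : ℝ) : ℝ :=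
  (∑ j, a y (Fin.last m) j.castSucc * ξ j) / ann a y

/-- `m(ξ, y) = (B(ξ,ξ,y)/a_{nn}(y))^{1/2}`. -/
def mfun (a : ℝ → Matrix (Fin (m + 1)) (Fin (m + 1)) ℝ) (ξ : Em m) (y : ℝ) : ℝ :=
  Real.sqrt (Bform a ξ ξ y / ann a y)

/-- `t(ξ + iτsγ, y)`, the ℂ-linear extension of `t` evaluated at `ξ + iτsγ`. -/
def tC (a : ℝ → Matrix (Fin (m + 1)) (Fin (m + 1)) ℝ) (ξ γ : Em m) (τ s y : ℝ) : ℂ :=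
  (tform a ξ y : ℂ) + Complex.I * ((τ * s : ℝ) : ℂ) * (tform a γ y : ℂ)

/-- `ζ(ξ,y) = a_{nn}(y)⁻¹ [B(ξ,ξ,y) + 2isτ B(ξ,γ,y) - s²τ² B(γ,γ,y)]`. -/
def zetafun (a : ℝ → Matrix (Fin (m + 1)) (Fin (m + 1)) ℝ) (ξ γ : Em m) (τ s y : ℝ) : ℂ :=
  ((ann a y : ℝ) : ℂ)⁻¹ *
    ((Bform a ξ ξ y : ℂ) + 2 * Complex.I * ((s * τ : ℝ) : ℂ) * (Bform a ξ γ y : ℂ) -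
      ((s * τ : ℝ) : ℂ) ^ 2 * (Bform a γ γ y : ℂ))

/-- The principal square root `√ζ`. -/
def sqz (a : ℝ → Matrix (Fin (m + 1)) (Fin (m + 1)) ℝ) (ξ γ : Em m) (τ s y : ℝ) : ℂ :=
  zetafun a ξ γ τ s y ^ ((1 : ℂ) / 2)

/-- The first-order factor `E v = ∂_y v + i t(ξ+iτsγ,y) v - (τφ' + √ζ) v`. -/
def Eop (a : ℝ → Matrix (Fin (m + 1)) (Fin (m + 1)) ℝ) (ξ γ : Em m) (τ s α β : ℝ)
    (v : ℝ → ℂ) (y : ℝ) : ℂ :=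
  deriv v y +
    (Complex.I * tC a ξ γ τ s y - (((τ * (α + β * y) : ℝ) : ℂ) + sqz a ξ γ τ s y)) * v y

/-- The first-order factor `F v = ∂_y v + i t(ξ+iτsγ,y) v - (τφ' - √ζ) v`. -/
def Fop (a : ℝ → Matrix (Fin (m + 1)) (Fin (m + 1)) ℝ) (ξ γ : Em m) (τ s α β : ℝ)
    (v : ℝ → ℂ) (y : ℝ) : ℂ :=
  deriv v y +
    (Complex.I * tC a ξ γ τ s y - (((τ * (α + β * y) : ℝ) : ℂ) - sqz a ξ γ τ s y)) * v y

/-- `a_{nn}(y) (∂_y - τφ' + i t(ξ+iτsγ,y)) v`. -/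
def Pinner (a : ℝ → Matrix (Fin (m + 1)) (Fin (m + 1)) ℝ) (ξ γ : Em m) (τ s α β : ℝ)
    (v : ℝ → ℂ) (y : ℝ) : ℂ :=
  (ann a y : ℂ) * (deriv v y + (Complex.I * tC a ξ γ τ s y - ((τ * (α + β * y) : ℝ) : ℂ)) * v y)

/-- The conjugated operator
`P v = (∂_y - τφ' + i t(ξ+iτsγ,y)) [a_{nn} (∂_y - τφ' + i t(ξ+iτsγ,y)) v] - a_{nn} ζ v`. -/
def Pop (a : ℝ → Matrix (Fin (m + 1)) (Fin (m + 1)) ℝ) (ξ γ : Em m) (τ s α β : ℝ)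
    (v : ℝ → ℂ) (y : ℝ) : ℂ :=
  deriv (Pinner a ξ γ τ s α β v) y +
    (Complex.I * tC a ξ γ τ s y - ((τ * (α + β * y) : ℝ) : ℂ)) * Pinner a ξ γ τ s α β v y -
    (ann a y : ℂ) * zetafun a ξ γ τ s y * v y

/-- `V(ξ) = a_{nn}(0) [∂_y v(0) - τα v(0) + i t(ξ+iτsγ,0) v(0)]`. -/
def Vval (a : ℝ → Matrix (Fin (m + 1)) (Fin (m + 1)) ℝ) (ξ γ : Em m) (τ s α : ℝ)
    (v : ℝ → ℂ) : ℂ :=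
  (ann a 0 : ℂ) * (deriv v 0 - ((τ * α : ℝ) : ℂ) * v 0 + Complex.I * tC a ξ γ τ s 0 * v 0)

/-- `ω₊ = a_{nn} F v`. -/
def omegaP (a : ℝ → Matrix (Fin (m + 1)) (Fin (m + 1)) ℝ) (ξ γ : Em m) (τ s α β : ℝ)
    (v : ℝ → ℂ) (y : ℝ) : ℂ :=
  (ann a y : ℂ) * Fop a ξ γ τ s α β v y

/-- `ω₋ = a_{nn} E v`. -/
def omegaM (a : ℝ → Matrix (Fin (m + 1)) (Fin (m + 1)) ℝ) (ξ γ : Em m) (τ s α β : ℝ)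
    (v : ℝ → ℂ) (y : ℝ) : ℂ :=
  (ann a y : ℂ) * Eop a ξ γ τ s α β v y

/-- Squared `L²` norm on `(0, ∞)`. -/
def L2p (v : ℝ → ℂ) : ℝ := ∫ y in Set.Ioi (0 : ℝ), ‖v y‖ ^ 2

/-- Squared `L²` norm on `(-∞, 0)`. -/
def L2m (v : ℝ → ℂ) : ℝ := ∫ y in Set.Iio (0 : ℝ), ‖v y‖ ^ 2

/-- `Λ = (|ξ|² + τ²)^{1/2}`. -/
def Lam (ξ : Em m) (τ : ℝ) : ℝ := Real.sqrt (‖ξ‖ ^ 2 + τ ^ 2)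

/-- `L = sup_{ξ ≠ 0} m₊(ξ,0)/m₋(ξ,0)`. -/
def Lconst (ap am : ℝ → Matrix (Fin (m + 1)) (Fin (m + 1)) ℝ) : ℝ :=
  ⨆ ξ : {ξ : Em m // ξ ≠ 0}, mfun ap ξ.1 0 / mfun am ξ.1 0

/-- `κ = (1 - L α₋/α₊)/2`. -/
def kappa (ap am : ℝ → Matrix (Fin (m + 1)) (Fin (m + 1)) ℝ) (αp αm : ℝ) : ℝ :=
  (1 - Lconst ap am * (αm / αp)) / 2

/-- The coefficient matrix `A(y)` is symmetric, uniformly elliptic with constant `λ₀`,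
and Lipschitz with constant `M₀`. -/
def GoodCoeff (lam0 M0 : ℝ) (a : ℝ → Matrix (Fin (m + 1)) (Fin (m + 1)) ℝ) : Prop :=
  (∀ y, (a y).IsSymm) ∧
  (∀ (y : ℝ) (z : EuclideanSpace ℝ (Fin (m + 1))),
      lam0 * ‖z‖ ^ 2 ≤ ∑ i, ∑ j, a y i j * z i * z j ∧
      ∑ i, ∑ j, a y i j * z i * z j ≤ lam0⁻¹ * ‖z‖ ^ 2) ∧
  (∀ y y' i j, |a y i j - a y' i j| ≤ M0 * |y - y'|)

/-- The ellipticity bounds `λ₁|ξ|² ≤ B(ξ,ξ,y) ≤ λ₁⁻¹|ξ|²`. -/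
def GoodB (lam1 : ℝ) (a : ℝ → Matrix (Fin (m + 1)) (Fin (m + 1)) ℝ) : Prop :=
  ∀ (ξ : Em m) (y : ℝ), lam1 * ‖ξ‖ ^ 2 ≤ Bform a ξ ξ y ∧ Bform a ξ ξ y ≤ lam1⁻¹ * ‖ξ‖ ^ 2

/-- The product of two locally Lipschitz complex functions is locally Lipschitz. -/
theorem LocallyLipschitz.complex_mul {f g : ℝ → ℂ} (hf : LocallyLipschitz f)
    (hg : LocallyLipschitz g) : LocallyLipschitz (fun t => f t * g t) := by
  have h : ContDiff ℝ 1 (fun q : ℂ × ℂ => q.1 * q.2) := by fun_prop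
  exact h.locallyLipschitz.comp (hf.prodMk hg)

/-- The sum of two locally Lipschitz complex functions is locally Lipschitz. -/
theorem LocallyLipschitz.complex_add {f g : ℝ → ℂ} (hf : LocallyLipschitz f)
    (hg : LocallyLipschitz g) : LocallyLipschitz (fun t => f t + g t) := by
  have h : ContDiff ℝ 1 (fun q : ℂ × ℂ => q.1 + q.2) := by fun_prop
  exact h.locallyLipschitz.comp (hf.prodMk hg)

/-- A locally Lipschitz function on the line is absolutely continuous on every interval. -/
theorem LocallyLipschitz.absolutelyContinuousOnInterval {X : Type*} [PseudoMetricSpace X]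
    {f : ℝ → X} (hf : LocallyLipschitz f) (x y : ℝ) : AbsolutelyContinuousOnInterval f x y := by
  obtain ⟨K, hK⟩ := (hf.locallyLipschitzOn (s := Set.uIcc x y)).exists_lipschitzOnWith_of_compact
    isCompact_uIcc
  exact hK.absolutelyContinuousOnInterval

/-- The derivative of a locally Lipschitz function, perturbed by a continuous function, is
square integrable on bounded intervals. -/
theorem LocallyLipschitz.intervalIntegrable_deriv_add_sq {u h : ℝ → ℂ} (hu : LocallyLipschitz u)
    (hh : Continuous h) (x y : ℝ) :
    IntervalIntegrable (fun t => ‖deriv u t + h t‖ ^ 2) volume x y := by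
  obtain ⟨K, hK⟩ :=
    (hu.locallyLipschitzOn (s := Set.Icc (min x y - 1) (max x y + 1))
      ).exists_lipschitzOnWith_of_compact isCompact_Icc
  obtain ⟨H, hH⟩ := (isCompact_uIcc (a := x) (b := y)).exists_bound_of_continuousOn
    hh.continuousOn
  have hmeas : Measurable (fun t => ‖deriv u t + h t‖ ^ 2) :=
    ((measurable_deriv u).add hh.measurable).norm.pow_const 2
  refine (intervalIntegrable_const (c := ((K : ℝ) + H) ^ 2)).mono_fun
    hmeas.aestronglyMeasurable ?_
  refine (ae_restrict_iff' measurableSet_uIoc).2 (Filter.Eventually.of_forall fun t ht => ?_)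
  have ht' := Set.uIoc_subset_uIcc ht
  have hd : ‖deriv u t‖ ≤ K := by
    refine norm_deriv_le_of_lipschitzOn (Icc_mem_nhds ?_ ?_) hK
    · have := ht'.1; linarith
    · have := ht'.2; linarith
  have hsum : ‖deriv u t + h t‖ ≤ K + H := (norm_add_le _ _).trans (add_le_add hd (hH t ht'))
  change ‖‖deriv u t + h t‖ ^ 2‖ ≤ ‖((K : ℝ) + H) ^ 2‖
  rw [Real.norm_of_nonneg (by positivity), Real.norm_of_nonneg (by positivity)]
  gcongr

/-- Energy estimate for a first-order operator `∂ + p` whose symbol has real part at most `-k`. -/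
theorem energy_estimate {u p : ℝ → ℂ} (hu : LocallyLipschitz u) (hp : Continuous p)
    {k x y : ℝ} (hk : 0 < k) (hxy : x ≤ y)
    (hre : ∀ t ∈ Set.Ioo x y, u t ≠ 0 → (p t).re ≤ -k) :
    k ^ 2 * (∫ t in x..y, ‖u t‖ ^ 2) + k * ‖u x‖ ^ 2 ≤
      (∫ t in x..y, ‖deriv u t + p t * u t‖ ^ 2) + k * ‖u y‖ ^ 2 := by
  have hsq : LocallyLipschitz (fun t => ‖u t‖ ^ 2) := by
    have h : ContDiff ℝ 1 (fun q : ℂ => ‖q‖ ^ 2) := contDiff_norm_sq ℝ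
    exact h.locallyLipschitz.comp hu
  have hac := hsq.absolutelyContinuousOnInterval x y
  have hftc := hac.integral_deriv_eq_sub
  have hdiff :=
    (hu.absolutelyContinuousOnInterval x y).boundedVariationOn.ae_differentiableAt_of_mem_uIcc
  have hgi : IntervalIntegrable (fun t => ‖deriv u t + p t * u t‖ ^ 2) volume x y :=
    hu.intervalIntegrable_deriv_add_sq (hp.mul hu.continuous) x y
  have hui : IntervalIntegrable (fun t => ‖u t‖ ^ 2) volume x y :=
    (hu.continuous.norm.pow 2).intervalIntegrable x y
  have hmono : ∫ t in x..y, (k ^ 2 * ‖u t‖ ^ 2 - ‖deriv u t + p t * u t‖ ^ 2) ≤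
      ∫ t in x..y, k * deriv (fun t => ‖u t‖ ^ 2) t := by
    refine intervalIntegral.integral_mono_ae_restrict hxy ((hui.const_mul _).sub hgi)
      (hac.intervalIntegrable_deriv.const_mul _) ?_
    rw [Filter.EventuallyLE, ae_restrict_iff' measurableSet_Icc]
    have h₁ : ∀ᵐ t : ℝ, t ≠ x := by simp [ae_iff, measure_singleton]
    have h₂ : ∀ᵐ t : ℝ, t ≠ y := by simp [ae_iff, measure_singleton]
    filter_upwards [hdiff, h₁, h₂] with t ht ht₁ ht₂ htm
    have hd := (ht (by rwa [Set.uIcc_of_le hxy])).hasDerivAt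
    rw [hd.norm_sq.deriv]
    have htm' : t ∈ Set.Ioo x y := ⟨lt_of_le_of_ne htm.1 (Ne.symm ht₁), lt_of_le_of_ne htm.2 ht₂⟩
    set g := deriv u t + p t * u t with hg
    have hdg : deriv u t = g - p t * u t := by rw [hg]; ring
    have hinner : inner ℝ (u t) (deriv u t) = inner ℝ (u t) g - (p t).re * ‖u t‖ ^ 2 := by
      rw [hdg, inner_sub_right]
      congr 1
      rw [Complex.inner, ← Complex.normSq_eq_norm_sq, Complex.normSq_apply]
      simp only [Complex.mul_re, Complex.mul_im, Complex.conj_re, Complex.conj_im]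
      ring
    have hcs : -(‖u t‖ * ‖g‖) ≤ inner ℝ (u t) g := (abs_le.1 (abs_real_inner_le_norm _ _)).1
    have hp' : k * ‖u t‖ ^ 2 ≤ -(p t).re * ‖u t‖ ^ 2 := by
      by_cases h0 : u t = 0
      · simp [h0]
      · gcongr
        linarith [hre t htm' h0]
    rw [hinner]
    nlinarith [sq_nonneg (k * ‖u t‖ - ‖g‖), mul_le_mul_of_nonneg_left hcs hk.le,
      mul_le_mul_of_nonneg_left hp' hk.le]
  rw [intervalIntegral.integral_sub (hui.const_mul _) hgi, intervalIntegral.integral_const_mul,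
    intervalIntegral.integral_const_mul, hftc] at hmono
  linarith

/-- Composition of two energy estimates: bounds for a second-order operator that factors, up to a
small zeroth-order term, as `(∂ + p) n (∂ + p)`. -/
theorem second_order_estimate {v w p z : ℝ → ℂ} {n : ℝ → ℝ} (hv : ContDiff ℝ 1 v)
    (hw : LocallyLipschitz w) (hp : Continuous p) (hz : Continuous z)
    {lam k q δ x y : ℝ} (hlam : 0 < lam) (hlam' : lam ≤ 1) (hk : 0 < k) (hxy : x ≤ y)
    (hn : ∀ t, lam ≤ n t) (hwv : ∀ t, w t = (n t : ℂ) * (deriv v t + p t * v t))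
    (hre : ∀ t ∈ Set.Ioo x y, t ∈ tsupport v → (p t).re ≤ -k)
    (hpq : ∀ t ∈ Set.Ioo x y, t ∈ tsupport v → ‖p t‖ ≤ q * k)
    (hzδ : ∀ t, ‖z t‖ ≤ δ) (hδ : 8 * δ ^ 2 ≤ lam ^ 2 * k ^ 4) :
    lam ^ 2 * (k * ‖w x‖ ^ 2 + k ^ 3 * ‖v x‖ ^ 2 + k ^ 4 * (∫ t in x..y, ‖v t‖ ^ 2) +
        k ^ 2 * (∫ t in x..y, ‖deriv v t‖ ^ 2)) ≤
      8 * (1 + 2 * q ^ 2) * ((∫ t in x..y, ‖deriv w t + p t * w t - z t * v t‖ ^ 2) +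
        k * ‖w y‖ ^ 2 + k ^ 3 * ‖v y‖ ^ 2) := by
  have hvL : LocallyLipschitz v := hv.locallyLipschitz
  have hdv : Continuous (deriv v) := hv.continuous_deriv le_rfl
  have hvc := hv.continuous
  have hwc := hw.continuous
  have hiv : IntervalIntegrable (fun t => ‖v t‖ ^ 2) volume x y :=
    (hvc.norm.pow 2).intervalIntegrable x y
  have hiw : IntervalIntegrable (fun t => ‖w t‖ ^ 2) volume x y :=
    (hwc.norm.pow 2).intervalIntegrable x y
  have hidv : IntervalIntegrable (fun t => ‖deriv v t‖ ^ 2) volume x y :=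
    (hdv.norm.pow 2).intervalIntegrable x y
  have hiDv : IntervalIntegrable (fun t => ‖deriv v t + p t * v t‖ ^ 2) volume x y :=
    ((hdv.add (hp.mul hvc)).norm.pow 2).intervalIntegrable x y
  have hiDw : IntervalIntegrable (fun t => ‖deriv w t + p t * w t‖ ^ 2) volume x y :=
    hw.intervalIntegrable_deriv_add_sq (hp.mul hwc) x y
  have hiP : IntervalIntegrable (fun t => ‖deriv w t + p t * w t - z t * v t‖ ^ 2) volume x y := by
    have := hw.intervalIntegrable_deriv_add_sq ((hp.mul hwc).sub (hz.mul hvc)) x y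
    simpa only [Pi.mul_apply, Pi.sub_apply, add_sub_assoc] using this
  have hwsupp : ∀ t, w t ≠ 0 → t ∈ tsupport v := by
    intro t ht
    by_contra hts
    apply ht
    rw [hwv, image_eq_zero_of_notMem_tsupport hts,
      Function.notMem_support.1 (fun h => hts (support_deriv_subset h))]
    simp
  have hDv : ∀ t, lam ^ 2 * ‖deriv v t + p t * v t‖ ^ 2 ≤ ‖w t‖ ^ 2 := by
    intro t
    rw [hwv, norm_mul, mul_pow, Complex.norm_real, Real.norm_of_nonneg (hlam.le.trans (hn t))]
    gcongr
    exact hn t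
  have e1 := energy_estimate hw hp hk hxy fun t ht h0 => hre t ht (hwsupp t h0)
  have e2 := energy_estimate hvL hp hk hxy fun t ht h0 => hre t ht (subset_tsupport v h0)
  have e3 : lam ^ 2 * (∫ t in x..y, ‖deriv v t + p t * v t‖ ^ 2) ≤ ∫ t in x..y, ‖w t‖ ^ 2 := by
    rw [← intervalIntegral.integral_const_mul]
    exact intervalIntegral.integral_mono_on hxy (hiDv.const_mul _) hiw fun t _ => hDv t
  have e4 : (∫ t in x..y, ‖deriv w t + p t * w t‖ ^ 2) ≤
      2 * (∫ t in x..y, ‖deriv w t + p t * w t - z t * v t‖ ^ 2) +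
        2 * δ ^ 2 * (∫ t in x..y, ‖v t‖ ^ 2) := by
    rw [← intervalIntegral.integral_const_mul, ← intervalIntegral.integral_const_mul,
      ← intervalIntegral.integral_add (hiP.const_mul _) (hiv.const_mul _)]
    refine intervalIntegral.integral_mono_on hxy hiDw
      ((hiP.const_mul _).add (hiv.const_mul _)) fun t _ => ?_
    have h1 : ‖deriv w t + p t * w t‖ ≤
        ‖deriv w t + p t * w t - z t * v t‖ + δ * ‖v t‖ := by
      calc ‖deriv w t + p t * w t‖
          = ‖(deriv w t + p t * w t - z t * v t) + z t * v t‖ := by rw [sub_add_cancel]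
        _ ≤ _ := (norm_add_le _ _).trans (by rw [norm_mul]; gcongr; exact hzδ t)
    nlinarith [norm_nonneg (deriv w t + p t * w t), pow_le_pow_left₀ (norm_nonneg _) h1 2,
      sq_nonneg (‖deriv w t + p t * w t - z t * v t‖ - δ * ‖v t‖)]
  have e5 : lam ^ 2 * (∫ t in x..y, ‖deriv v t‖ ^ 2) ≤
      2 * (∫ t in x..y, ‖w t‖ ^ 2) +
        2 * lam ^ 2 * (q * k) ^ 2 * (∫ t in x..y, ‖v t‖ ^ 2) := by
    rw [← intervalIntegral.integral_const_mul, ← intervalIntegral.integral_const_mul,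
      ← intervalIntegral.integral_const_mul,
      ← intervalIntegral.integral_add (hiw.const_mul _) (hiv.const_mul _)]
    refine intervalIntegral.integral_mono_on_of_le_Ioo hxy (hidv.const_mul _)
      ((hiw.const_mul _).add (hiv.const_mul _)) fun t ht => ?_
    have h1 : ‖deriv v t‖ ≤ ‖deriv v t + p t * v t‖ + q * k * ‖v t‖ := by
      have h2 : ‖p t * v t‖ ≤ q * k * ‖v t‖ := by
        rw [norm_mul]
        by_cases h0 : v t = 0
        · simp [h0]
        · gcongr
          exact hpq t ht (subset_tsupport v h0)
      calc ‖deriv v t‖ = ‖(deriv v t + p t * v t) - p t * v t‖ := by rw [add_sub_cancel_right]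
        _ ≤ _ := (norm_sub_le _ _).trans (by gcongr)
    have h3 : ‖deriv v t‖ ^ 2 ≤ 2 * ‖deriv v t + p t * v t‖ ^ 2 + 2 * (q * k) ^ 2 * ‖v t‖ ^ 2 := by
      nlinarith [norm_nonneg (deriv v t), pow_le_pow_left₀ (norm_nonneg _) h1 2,
        sq_nonneg (‖deriv v t + p t * v t‖ - q * k * ‖v t‖)]
    nlinarith [hDv t, mul_le_mul_of_nonneg_left h3 (sq_nonneg lam)]
  have hA : 0 ≤ ∫ t in x..y, ‖v t‖ ^ 2 :=
    intervalIntegral.integral_nonneg hxy fun t _ => by positivity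
  have hW : 0 ≤ ∫ t in x..y, ‖w t‖ ^ 2 :=
    intervalIntegral.integral_nonneg hxy fun t _ => by positivity
  have hG : 0 ≤ ∫ t in x..y, ‖deriv w t + p t * w t - z t * v t‖ ^ 2 :=
    intervalIntegral.integral_nonneg hxy fun t _ => by positivity
  generalize (∫ t in x..y, ‖deriv w t + p t * w t - z t * v t‖ ^ 2) = G at *
  generalize (∫ t in x..y, ‖deriv w t + p t * w t‖ ^ 2) = Dw at *
  generalize (∫ t in x..y, ‖deriv v t + p t * v t‖ ^ 2) = Dv at *
  generalize (∫ t in x..y, ‖deriv v t‖ ^ 2) = N at *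
  generalize (∫ t in x..y, ‖v t‖ ^ 2) = A at *
  generalize (∫ t in x..y, ‖w t‖ ^ 2) = W at *
  have hwx : 0 ≤ ‖w x‖ ^ 2 := by positivity
  have hwy : 0 ≤ ‖w y‖ ^ 2 := by positivity
  have hvx : 0 ≤ ‖v x‖ ^ 2 := by positivity
  have hvy : 0 ≤ ‖v y‖ ^ 2 := by positivity
  generalize ‖w x‖ ^ 2 = wx at *
  generalize ‖w y‖ ^ 2 = wy at *
  generalize ‖v x‖ ^ 2 = vx at *
  generalize ‖v y‖ ^ 2 = vy at *
  have hl2 : lam ^ 2 ≤ 1 := pow_le_one₀ hlam.le hlam'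
  have f1 : lam ^ 2 * k ^ 4 * A + lam ^ 2 * k ^ 3 * vx ≤ k ^ 2 * W + lam ^ 2 * k ^ 3 * vy := by
    have h1 := mul_le_mul_of_nonneg_left e2 (by positivity : 0 ≤ lam ^ 2 * k ^ 2)
    have h2 := mul_le_mul_of_nonneg_left e3 (by positivity : 0 ≤ k ^ 2)
    linarith
  have f2 := mul_le_mul_of_nonneg_right hδ hA
  have f3 : 2 * k ^ 2 * W + 4 * k * wx + lam ^ 2 * k ^ 4 * A + 2 * lam ^ 2 * k ^ 3 * vx ≤
      8 * G + 4 * k * wy + 2 * lam ^ 2 * k ^ 3 * vy := by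
    linarith
  have f4 : lam ^ 2 * (k ^ 4 * A + k ^ 2 * N) ≤
      2 * k ^ 2 * W + (1 + 2 * q ^ 2) * (lam ^ 2 * k ^ 4 * A) := by
    have h1 := mul_le_mul_of_nonneg_left e5 (by positivity : 0 ≤ k ^ 2)
    linarith
  have f5 := mul_le_mul_of_nonneg_left f3 (by positivity : 0 ≤ 1 + 2 * q ^ 2)
  have g1 : 0 ≤ q ^ 2 * (k ^ 2 * W) := by positivity
  have g2 : 0 ≤ q ^ 2 * (k * wx) := by positivity
  have g3 : 0 ≤ q ^ 2 * (lam ^ 2 * k ^ 3 * vx) := by positivity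
  have g4 : 0 ≤ lam ^ 2 * k ^ 3 * vx := by positivity
  have g5 : lam ^ 2 * (k * wx) ≤ k * wx := mul_le_of_le_one_left (by positivity) hl2
  have g6 : lam ^ 2 * (k ^ 3 * vy) ≤ k ^ 3 * vy := mul_le_of_le_one_left (by positivity) hl2
  have g7 : 0 ≤ k * wx := by positivity
  have f6 : lam ^ 2 * (k * wx + k ^ 3 * vx + k ^ 4 * A + k ^ 2 * N) ≤
      (1 + 2 * q ^ 2) * (8 * G + 4 * k * wy + 2 * lam ^ 2 * k ^ 3 * vy) := by
    linarith
  have g8 : 0 ≤ k * wy := by positivity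
  have g9 : 0 ≤ k ^ 3 * vy := by positivity
  have f7 : 8 * G + 4 * k * wy + 2 * lam ^ 2 * k ^ 3 * vy ≤
      8 * (G + k * wy + k ^ 3 * vy) := by
    linarith
  have f8 := mul_le_mul_of_nonneg_left f7 (by positivity : 0 ≤ 1 + 2 * q ^ 2)
  linarith

/-- The diagonal entries of an elliptic coefficient matrix are at least `λ₀`. -/
theorem GoodCoeff.le_diag {lam0 M0 : ℝ} {a : ℝ → Matrix (Fin (m + 1)) (Fin (m + 1)) ℝ}
    (ha : GoodCoeff lam0 M0 a) (y : ℝ) (i : Fin (m + 1)) : lam0 ≤ a y i i := by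
  have h := (ha.2.1 y (EuclideanSpace.single i 1)).1
  simpa [Pi.single_apply] using h

/-- The diagonal entries of an elliptic coefficient matrix are at most `λ₀⁻¹`. -/
theorem GoodCoeff.diag_le {lam0 M0 : ℝ} {a : ℝ → Matrix (Fin (m + 1)) (Fin (m + 1)) ℝ}
    (ha : GoodCoeff lam0 M0 a) (y : ℝ) (i : Fin (m + 1)) : a y i i ≤ lam0⁻¹ := by
  have h := (ha.2.1 y (EuclideanSpace.single i 1)).2
  simpa [Pi.single_apply] using h

/-- All entries of an elliptic coefficient matrix are bounded by `λ₀⁻¹`. -/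
theorem GoodCoeff.abs_entry_le {lam0 M0 : ℝ} (hlam0 : 0 < lam0)
    {a : ℝ → Matrix (Fin (m + 1)) (Fin (m + 1)) ℝ}
    (ha : GoodCoeff lam0 M0 a) (y : ℝ) (i j : Fin (m + 1)) : |a y i j| ≤ lam0⁻¹ := by
  have hii := ha.le_diag y i
  have hii' := ha.diag_le y i
  have hjj' := ha.diag_le y j
  by_cases hij : i = j
  · subst hij
    rw [abs_of_nonneg (hlam0.le.trans hii)]
    exact hii'
  have hsymm : a y j i = a y i j := (ha.1 y).apply i j
  have key : ∀ r : ℝ, 0 ≤ a y i i + 2 * r * a y i j + r ^ 2 * a y j j := by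
    intro r
    have h := (ha.2.1 y (EuclideanSpace.single i 1 + EuclideanSpace.single j r)).1
    have h0 : 0 ≤ lam0 * ‖EuclideanSpace.single i (1 : ℝ) + EuclideanSpace.single j r‖ ^ 2 := by
      positivity
    have h1 := h0.trans h
    simp only [PiLp.add_apply, PiLp.single_apply, mul_add, add_mul, mul_ite, mul_one,
      mul_zero, ite_mul, zero_mul, Finset.sum_add_distrib, Finset.sum_ite_eq', Finset.mem_univ,
      if_true, hsymm] at h1
    linarith
  rw [abs_le]
  constructor <;> nlinarith [key 1, key (-1)]

/-- The entries of a Lipschitz coefficient matrix are Lipschitz. -/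
theorem GoodCoeff.locallyLipschitz_entry {lam0 M0 : ℝ}
    {a : ℝ → Matrix (Fin (m + 1)) (Fin (m + 1)) ℝ}
    (ha : GoodCoeff lam0 M0 a) (i j : Fin (m + 1)) : LocallyLipschitz (fun y => a y i j) :=
  (LipschitzWith.of_dist_le' (K := M0) fun y y' => by
    simpa [Real.dist_eq] using ha.2.2 y y' i j).locallyLipschitz

/-- The entries of a Lipschitz coefficient matrix are continuous. -/
theorem GoodCoeff.continuous_entry {lam0 M0 : ℝ}
    {a : ℝ → Matrix (Fin (m + 1)) (Fin (m + 1)) ℝ}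
    (ha : GoodCoeff lam0 M0 a) (i j : Fin (m + 1)) : Continuous (fun y => a y i j) :=
  (ha.locallyLipschitz_entry i j).continuous

/-- The numerator `Σ_j a_{nj} ξ_j` of `t(ξ, y)`. -/
def tnum (a : ℝ → Matrix (Fin (m + 1)) (Fin (m + 1)) ℝ) (ξ : Em m) (y : ℝ) : ℝ :=
  ∑ j, a y (Fin.last m) j.castSucc * ξ j

theorem GoodCoeff.locallyLipschitz_tnum {lam0 M0 : ℝ}
    {a : ℝ → Matrix (Fin (m + 1)) (Fin (m + 1)) ℝ}
    (ha : GoodCoeff lam0 M0 a) (ξ : Em m) :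
    LocallyLipschitz (fun y => ((tnum a ξ y : ℝ) : ℂ)) := by
  have h : LocallyLipschitz (fun y => fun j : Fin m => a y (Fin.last m) j.castSucc) := by
    refine (LipschitzWith.of_dist_le' (K := |M0|) fun y y' => ?_).locallyLipschitz
    refine (dist_pi_le_iff (by positivity)).2 fun j => ?_
    rw [Real.dist_eq, Real.dist_eq]
    exact (ha.2.2 y y' _ _).trans (by gcongr; exact le_abs_self _)
  have hc : ContDiff ℝ 1 (fun q : Fin m → ℝ => ∑ j, q j * ξ j) :=
    ContDiff.sum fun j _ => by fun_prop
  have hof : ContDiff ℝ 1 (fun r : ℝ => (r : ℂ)) := Complex.ofRealCLM.contDiff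
  exact hof.locallyLipschitz.comp (hc.locallyLipschitz.comp h)

theorem GoodCoeff.continuous_tform {lam0 M0 : ℝ} (hlam0 : 0 < lam0)
    {a : ℝ → Matrix (Fin (m + 1)) (Fin (m + 1)) ℝ}
    (ha : GoodCoeff lam0 M0 a) (ξ : Em m) : Continuous (tform a ξ) := by
  unfold tform ann
  refine Continuous.div (continuous_finsetSum _ fun j _ => ?_) (ha.continuous_entry _ _) fun y => ?_
  · exact (ha.continuous_entry _ _).mul continuous_const
  · exact (hlam0.trans_le (ha.le_diag y _)).ne'

theorem GoodCoeff.continuous_Bform {lam0 M0 : ℝ} (hlam0 : 0 < lam0)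
    {a : ℝ → Matrix (Fin (m + 1)) (Fin (m + 1)) ℝ}
    (ha : GoodCoeff lam0 M0 a) (ξ η : Em m) : Continuous (Bform a ξ η) := by
  unfold Bform bcoef ann
  refine continuous_finsetSum _ fun j _ => continuous_finsetSum _ fun k _ => ?_
  refine ((Continuous.sub (ha.continuous_entry _ _) (Continuous.div
    ((ha.continuous_entry _ _).mul (ha.continuous_entry _ _)) (ha.continuous_entry _ _)
    fun y => ?_)).mul continuous_const).mul continuous_const
  exact (hlam0.trans_le (ha.le_diag y _)).ne'

theorem GoodCoeff.abs_tform_le {lam0 M0 : ℝ} (hlam0 : 0 < lam0)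
    {a : ℝ → Matrix (Fin (m + 1)) (Fin (m + 1)) ℝ}
    (ha : GoodCoeff lam0 M0 a) (ξ : Em m) (y : ℝ) :
    |tform a ξ y| ≤ m * lam0⁻¹ ^ 2 * ‖ξ‖ := by
  have hn : lam0 ≤ ann a y := ha.le_diag y _
  have hn' : 0 ≤ (ann a y)⁻¹ := inv_nonneg.2 (hlam0.le.trans hn)
  have hsum : |∑ j, a y (Fin.last m) j.castSucc * ξ j| ≤ m * (lam0⁻¹ * ‖ξ‖) := by
    refine (Finset.abs_sum_le_sum_abs _ _).trans ?_
    refine (Finset.sum_le_card_nsmul _ _ (lam0⁻¹ * ‖ξ‖) fun j _ => ?_).trans (by simp)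
    rw [abs_mul]
    gcongr
    · exact ha.abs_entry_le hlam0 _ _ _
    · exact PiLp.norm_apply_le ξ j
  rw [tform, abs_div, abs_of_pos (hlam0.trans_le hn), div_eq_mul_inv]
  calc _ ≤ m * (lam0⁻¹ * ‖ξ‖) * lam0⁻¹ := by gcongr
    _ = _ := by ring

theorem GoodCoeff.abs_Bform_le {lam0 M0 : ℝ} (hlam0 : 0 < lam0)
    {a : ℝ → Matrix (Fin (m + 1)) (Fin (m + 1)) ℝ}
    (ha : GoodCoeff lam0 M0 a) (ξ η : Em m) (y : ℝ) :
    |Bform a ξ η y| ≤ m ^ 2 * (lam0⁻¹ + lam0⁻¹ ^ 3) * ‖ξ‖ * ‖η‖ := by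
  have hn : lam0 ≤ ann a y := ha.le_diag y _
  have hn' : 0 ≤ (ann a y)⁻¹ := inv_nonneg.2 (hlam0.le.trans hn)
  have hb : ∀ j k, |bcoef a j k y| ≤ lam0⁻¹ + lam0⁻¹ ^ 3 := by
    intro j k
    refine (abs_sub _ _).trans (add_le_add (ha.abs_entry_le hlam0 _ _ _) ?_)
    rw [abs_div, abs_of_pos (hlam0.trans_le hn), abs_mul, div_eq_mul_inv]
    calc _ ≤ lam0⁻¹ * lam0⁻¹ * lam0⁻¹ := by
          gcongr
          · exact ha.abs_entry_le hlam0 _ _ _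
          · exact ha.abs_entry_le hlam0 _ _ _
      _ = _ := by ring
  have hpos : 0 ≤ lam0⁻¹ + lam0⁻¹ ^ 3 := by positivity
  calc |Bform a ξ η y| ≤ ∑ _j : Fin m, ∑ _k : Fin m, (lam0⁻¹ + lam0⁻¹ ^ 3) * ‖ξ‖ * ‖η‖ := by
        refine (Finset.abs_sum_le_sum_abs _ _).trans (Finset.sum_le_sum fun j _ => ?_)
        refine (Finset.abs_sum_le_sum_abs _ _).trans (Finset.sum_le_sum fun k _ => ?_)
        rw [abs_mul, abs_mul]
        gcongr
        · exact hb j k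
        · exact PiLp.norm_apply_le ξ j
        · exact PiLp.norm_apply_le η k
    _ = _ := by simp; ring

/-- The zeroth-order symbol `i t(ξ+iτsγ, y) - τ φ'(y)` of the conjugated normal derivative. -/
def normalSymbol (a : ℝ → Matrix (Fin (m + 1)) (Fin (m + 1)) ℝ) (ξ γ : Em m) (τ s α β : ℝ)
    (y : ℝ) : ℂ :=
  Complex.I * tC a ξ γ τ s y - ((τ * (α + β * y) : ℝ) : ℂ)

theorem normalSymbol_eq (a : ℝ → Matrix (Fin (m + 1)) (Fin (m + 1)) ℝ) (ξ γ : Em m)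
    (τ s α β y : ℝ) :
    normalSymbol a ξ γ τ s α β y =
      ((-(τ * s * tform a γ y) - τ * (α + β * y) : ℝ) : ℂ) + ((tform a ξ y : ℝ) : ℂ) * Complex.I := by
  rw [normalSymbol, tC]
  push_cast
  linear_combination (τ * s * tform a γ y : ℂ) * Complex.I_mul_I

theorem normalSymbol_re (a : ℝ → Matrix (Fin (m + 1)) (Fin (m + 1)) ℝ) (ξ γ : Em m)
    (τ s α β y : ℝ) :
    (normalSymbol a ξ γ τ s α β y).re = -(τ * s * tform a γ y) - τ * (α + β * y) := by
  rw [normalSymbol_eq]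
  simp

theorem norm_normalSymbol_le (a : ℝ → Matrix (Fin (m + 1)) (Fin (m + 1)) ℝ) (ξ γ : Em m)
    (τ s α β y : ℝ) :
    ‖normalSymbol a ξ γ τ s α β y‖ ≤
      |τ * s * tform a γ y| + |τ * (α + β * y)| + |tform a ξ y| := by
  rw [normalSymbol_eq]
  refine (norm_add_le _ _).trans (add_le_add ?_ ?_)
  · rw [Complex.norm_real, Real.norm_eq_abs]
    exact (abs_sub _ _).trans (by rw [abs_neg])
  · rw [norm_mul, Complex.norm_real, Complex.norm_I, mul_one, Real.norm_eq_abs]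

theorem GoodCoeff.continuous_normalSymbol {lam0 M0 : ℝ} (hlam0 : 0 < lam0)
    {a : ℝ → Matrix (Fin (m + 1)) (Fin (m + 1)) ℝ} (ha : GoodCoeff lam0 M0 a) (ξ γ : Em m)
    (τ s α β : ℝ) : Continuous (normalSymbol a ξ γ τ s α β) := by
  have h1 := ha.continuous_tform hlam0 ξ
  have h2 := ha.continuous_tform hlam0 γ
  rw [show normalSymbol a ξ γ τ s α β = _ from funext (normalSymbol_eq a ξ γ τ s α β)]
  fun_prop

/-- `a_{nn} ζ`, the zeroth-order coefficient of `P`. -/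
theorem GoodCoeff.ann_mul_zetafun {lam0 M0 : ℝ} (hlam0 : 0 < lam0)
    {a : ℝ → Matrix (Fin (m + 1)) (Fin (m + 1)) ℝ} (ha : GoodCoeff lam0 M0 a) (ξ γ : Em m)
    (τ s y : ℝ) :
    (ann a y : ℂ) * zetafun a ξ γ τ s y =
      (Bform a ξ ξ y : ℂ) + 2 * Complex.I * ((s * τ : ℝ) : ℂ) * (Bform a ξ γ y : ℂ) -
        ((s * τ : ℝ) : ℂ) ^ 2 * (Bform a γ γ y : ℂ) := by
  have h : (ann a y : ℂ) ≠ 0 := by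
    exact_mod_cast (hlam0.trans_le (ha.le_diag y (Fin.last m))).ne'
  rw [zetafun, mul_inv_cancel_left₀ h]

theorem GoodCoeff.continuous_ann_mul_zetafun {lam0 M0 : ℝ} (hlam0 : 0 < lam0)
    {a : ℝ → Matrix (Fin (m + 1)) (Fin (m + 1)) ℝ} (ha : GoodCoeff lam0 M0 a) (ξ γ : Em m)
    (τ s : ℝ) : Continuous (fun y => (ann a y : ℂ) * zetafun a ξ γ τ s y) := by
  have h1 := ha.continuous_Bform hlam0 ξ ξ
  have h2 := ha.continuous_Bform hlam0 ξ γ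
  have h3 := ha.continuous_Bform hlam0 γ γ
  simp only [ha.ann_mul_zetafun hlam0]
  fun_prop

theorem GoodCoeff.norm_ann_mul_zetafun_le {lam0 M0 : ℝ} (hlam0 : 0 < lam0)
    {a : ℝ → Matrix (Fin (m + 1)) (Fin (m + 1)) ℝ} (ha : GoodCoeff lam0 M0 a) {ξ γ : Em m}
    (hγ : ‖γ‖ ≤ 1) {τ s : ℝ} (hs : 0 ≤ s) (hτ : 0 ≤ τ) (y : ℝ) :
    ‖(ann a y : ℂ) * zetafun a ξ γ τ s y‖ ≤
      m ^ 2 * (lam0⁻¹ + lam0⁻¹ ^ 3) * (‖ξ‖ + s * τ) ^ 2 := by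
  have hB : 0 ≤ (m : ℝ) ^ 2 * (lam0⁻¹ + lam0⁻¹ ^ 3) := by positivity
  have h1 := ha.abs_Bform_le hlam0 ξ ξ y
  have h2 := ha.abs_Bform_le hlam0 ξ γ y
  have h3 := ha.abs_Bform_le hlam0 γ γ y
  generalize (m : ℝ) ^ 2 * (lam0⁻¹ + lam0⁻¹ ^ 3) = B at *
  have hsτ : 0 ≤ s * τ := mul_nonneg hs hτ
  have h2' : |Bform a ξ γ y| ≤ B * ‖ξ‖ :=
    h2.trans (mul_le_of_le_one_right (by positivity) hγ)
  have h3' : |Bform a γ γ y| ≤ B :=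
    h3.trans (mul_le_of_le_one_right (by positivity) hγ |>.trans
      (mul_le_of_le_one_right hB hγ))
  rw [ha.ann_mul_zetafun hlam0]
  calc _ ≤ |Bform a ξ ξ y| + 2 * (s * τ) * |Bform a ξ γ y| + (s * τ) ^ 2 * |Bform a γ γ y| := by
        refine (norm_sub_le _ _).trans (add_le_add ((norm_add_le _ _).trans ?_) ?_)
        · simp only [norm_mul, Complex.norm_real, Complex.norm_I, Real.norm_eq_abs,
            Complex.norm_ofNat, mul_one, abs_of_nonneg hs, abs_of_nonneg hτ, le_refl]
        · rw [norm_mul, norm_pow, Complex.norm_real, Complex.norm_real, Real.norm_eq_abs,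
            Real.norm_eq_abs, abs_of_nonneg hsτ]
    _ ≤ B * ‖ξ‖ * ‖ξ‖ + 2 * (s * τ) * (B * ‖ξ‖) + (s * τ) ^ 2 * B := by gcongr
    _ = _ := by ring

theorem GoodCoeff.locallyLipschitz_Pinner {lam0 M0 : ℝ} (hlam0 : 0 < lam0)
    {a : ℝ → Matrix (Fin (m + 1)) (Fin (m + 1)) ℝ} (ha : GoodCoeff lam0 M0 a) (ξ γ : Em m)
    (τ s α β : ℝ) {v : ℝ → ℂ} (hv : ContDiff ℝ 2 v) :
    LocallyLipschitz (Pinner a ξ γ τ s α β v) := by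
  have hN : LocallyLipschitz (fun y => ((ann a y : ℝ) : ℂ)) :=
    (Complex.ofRealCLM.contDiff (n := 1)).locallyLipschitz.comp (ha.locallyLipschitz_entry _ _)
  have hv1 : ContDiff ℝ 1 v := hv.of_le (by norm_num)
  have hdv : ContDiff ℝ 1 (deriv v) := by
    have : ContDiff ℝ (1 + 1) v := by simpa [one_add_one_eq_two] using hv
    exact (contDiff_succ_iff_deriv.1 this).2.2
  have hof : ContDiff ℝ 1 (fun y : ℝ => (y : ℂ)) := Complex.ofRealCLM.contDiff
  have h1 : ContDiff ℝ 1 (fun y : ℝ =>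
      deriv v y + -((τ : ℂ) * ((α : ℂ) + (β : ℂ) * (y : ℂ))) * v y) := by
    fun_prop
  have h2 : ContDiff ℝ 1 (fun y : ℝ => Complex.I * v y) := by fun_prop
  have h3 : ContDiff ℝ 1 (fun y : ℝ => -((τ : ℂ) * (s : ℂ)) * v y) := by fun_prop
  have key := ((hN.complex_mul h1.locallyLipschitz).complex_add
    ((ha.locallyLipschitz_tnum ξ).complex_mul h2.locallyLipschitz)).complex_add
    ((ha.locallyLipschitz_tnum γ).complex_mul h3.locallyLipschitz)
  convert key using 1
  funext y
  have h : (ann a y : ℂ) ≠ 0 := by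
    exact_mod_cast (hlam0.trans_le (ha.le_diag y (Fin.last m))).ne'
  have ht : ∀ η : Em m, ((tform a η y : ℝ) : ℂ) * (ann a y : ℂ) = ((tnum a η y : ℝ) : ℂ) := by
    intro η
    rw [show tform a η y = tnum a η y / ann a y from rfl]
    push_cast
    exact div_mul_cancel₀ _ h
  have hp := normalSymbol_eq a ξ γ τ s α β y
  rw [normalSymbol] at hp
  rw [Pinner, hp, ← ht, ← ht]
  push_cast
  ring

/-- One-sided estimate for the conjugated operator: on an interval where `φ'` is bounded and
bounded below, the traces at the left end and the interior norms are controlled by `P v` and the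
traces at the right end, provided that `s` and `|ξ|/τ` are small. -/
theorem exists_one_sided_estimate (m : ℕ) {lam0 : ℝ} (M0 : ℝ) (hlam0 : 0 < lam0)
    (hlam0' : lam0 ≤ 1) {c : ℝ} (M : ℝ) (hc : 0 < c) (hc' : c ≤ 1) :
    ∃ ρ > 0, ρ ≤ 1 ∧ ∃ K > 0, ∀ a : ℝ → Matrix (Fin (m + 1)) (Fin (m + 1)) ℝ,
      GoodCoeff lam0 M0 a → ∀ γ ξ : Em m, ‖γ‖ ≤ 1 → ∀ τ s α β : ℝ, 1 ≤ τ → 0 < s → s ≤ ρ →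
      ‖ξ‖ ≤ ρ * τ → ∀ v : ℝ → ℂ, ContDiff ℝ 2 v → ∀ x y : ℝ, x ≤ y →
      (∀ t ∈ Set.Ioo x y, t ∈ tsupport v → c ≤ α + β * t ∧ α + β * t ≤ M) →
      τ * ‖Pinner a ξ γ τ s α β v x‖ ^ 2 + τ ^ 3 * ‖v x‖ ^ 2 +
          τ ^ 4 * (∫ t in x..y, ‖v t‖ ^ 2) + τ ^ 2 * (∫ t in x..y, ‖deriv v t‖ ^ 2) ≤
        K * ((∫ t in x..y, ‖Pop a ξ γ τ s α β v t‖ ^ 2) +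
          τ * ‖Pinner a ξ γ τ s α β v y‖ ^ 2 + τ ^ 3 * ‖v y‖ ^ 2) := by
  set T : ℝ := m * lam0⁻¹ ^ 2 with hT
  set B : ℝ := m ^ 2 * (lam0⁻¹ + lam0⁻¹ ^ 3) with hBdef
  have hT0 : 0 ≤ T := by positivity
  have hB0 : 0 ≤ B := by positivity
  set κ : ℝ := c / 2 with hκ
  have hκ0 : 0 < κ := by positivity
  have hκ1 : κ ≤ 1 := by linarith
  set q : ℝ := (2 * T + M) / κ with hq
  set ρ : ℝ := min 1 (min (c / (2 * (T + 1))) (lam0 ^ 2 * κ ^ 4 / (128 * (B ^ 2 + 1)))) with hρ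
  have hρ0 : 0 < ρ := by positivity
  have hρ1 : ρ ≤ 1 := min_le_left _ _
  have hρ2 : ρ ≤ c / (2 * (T + 1)) := (min_le_right _ _).trans (min_le_left _ _)
  have hρ3 : ρ ≤ lam0 ^ 2 * κ ^ 4 / (128 * (B ^ 2 + 1)) :=
    (min_le_right _ _).trans (min_le_right _ _)
  clear_value ρ
  rw [le_div_iff₀ (by positivity)] at hρ2 hρ3
  refine ⟨ρ, hρ0, hρ1, 8 * (1 + 2 * q ^ 2) / (lam0 ^ 2 * κ ^ 4), by positivity, ?_⟩
  intro a ha γ ξ hγ τ s α β hτ hs hsρ hξ v hv x y hxy hφ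
  have hτ0 : 0 < τ := by linarith
  have htγ : ∀ t, |τ * s * tform a γ t| ≤ τ * (ρ * T) := by
    intro t
    rw [abs_mul, abs_mul, abs_of_pos hτ0, abs_of_pos hs, mul_assoc]
    gcongr
    exact (ha.abs_tform_le hlam0 γ t).trans (mul_le_of_le_one_right hT0 hγ)
  have htξ : ∀ t, |tform a ξ t| ≤ τ * (ρ * T) := by
    intro t
    calc |tform a ξ t| ≤ T * ‖ξ‖ := ha.abs_tform_le hlam0 ξ t
      _ ≤ T * (ρ * τ) := by gcongr
      _ = τ * (ρ * T) := by ring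
  have hρT : ρ * T ≤ κ := by linarith
  have hρT' : ρ * T ≤ T := mul_le_of_le_one_left hT0 hρ1
  have hz : ∀ t, ‖(ann a t : ℂ) * zetafun a ξ γ τ s t‖ ≤ 4 * B * ρ * τ ^ 2 := by
    intro t
    have h1 : ‖ξ‖ + s * τ ≤ 2 * (ρ * τ) := by
      have : s * τ ≤ ρ * τ := by gcongr
      linarith
    calc _ ≤ B * (‖ξ‖ + s * τ) ^ 2 := ha.norm_ann_mul_zetafun_le hlam0 hγ hs.le hτ0.le t
      _ ≤ B * (2 * (ρ * τ)) ^ 2 := by gcongr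
      _ = 4 * B * (ρ * ρ) * τ ^ 2 := by ring
      _ ≤ 4 * B * (ρ * 1) * τ ^ 2 := by gcongr
      _ = _ := by ring
  have hδ : 8 * (4 * B * ρ * τ ^ 2) ^ 2 ≤ lam0 ^ 2 * (κ * τ) ^ 4 := by
    calc 8 * (4 * B * ρ * τ ^ 2) ^ 2 = 128 * B ^ 2 * (ρ * ρ) * τ ^ 4 := by ring
      _ ≤ 128 * B ^ 2 * (ρ * 1) * τ ^ 4 := by gcongr
      _ = ρ * (128 * B ^ 2) * τ ^ 4 := by ring
      _ ≤ ρ * (128 * (B ^ 2 + 1)) * τ ^ 4 := by gcongr; linarith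
      _ ≤ lam0 ^ 2 * κ ^ 4 * τ ^ 4 := by gcongr
      _ = _ := by ring
  have hmain := second_order_estimate (v := v) (w := Pinner a ξ γ τ s α β v)
    (p := normalSymbol a ξ γ τ s α β) (z := fun t => (ann a t : ℂ) * zetafun a ξ γ τ s t)
    (n := ann a) (lam := lam0) (k := κ * τ) (q := q) (δ := 4 * B * ρ * τ ^ 2) (x := x) (y := y)
    (hv.of_le (by norm_num)) (ha.locallyLipschitz_Pinner hlam0 ξ γ τ s α β hv)
    (ha.continuous_normalSymbol hlam0 ξ γ τ s α β)
    (ha.continuous_ann_mul_zetafun hlam0 ξ γ τ s) hlam0 hlam0' (by positivity) hxy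
    (fun t => ha.le_diag t _) (fun t => rfl)
    (fun t ht hts => ?_) (fun t ht hts => ?_) hz hδ
  · have hP : (∫ t in x..y, ‖deriv (Pinner a ξ γ τ s α β v) t +
        normalSymbol a ξ γ τ s α β t * Pinner a ξ γ τ s α β v t -
        (ann a t : ℂ) * zetafun a ξ γ τ s t * v t‖ ^ 2) =
        ∫ t in x..y, ‖Pop a ξ γ τ s α β v t‖ ^ 2 := rfl
    rw [hP] at hmain
    have hA : 0 ≤ ∫ t in x..y, ‖v t‖ ^ 2 :=
      intervalIntegral.integral_nonneg hxy fun t _ => by positivity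
    have hN : 0 ≤ ∫ t in x..y, ‖deriv v t‖ ^ 2 :=
      intervalIntegral.integral_nonneg hxy fun t _ => by positivity
    generalize (∫ t in x..y, ‖Pop a ξ γ τ s α β v t‖ ^ 2) = G at *
    generalize (∫ t in x..y, ‖v t‖ ^ 2) = A at *
    generalize (∫ t in x..y, ‖deriv v t‖ ^ 2) = N at *
    generalize Pinner a ξ γ τ s α β v = w at *
    have hk3 : κ ^ 3 ≤ 1 := pow_le_one₀ hκ0.le hκ1
    have hκ41 : κ ^ 4 ≤ κ := pow_le_of_le_one hκ0.le hκ1 (by norm_num)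
    have hκ43 : κ ^ 4 ≤ κ ^ 3 := pow_le_pow_of_le_one hκ0.le hκ1 (by norm_num)
    have hκ42 : κ ^ 4 ≤ κ ^ 2 := pow_le_pow_of_le_one hκ0.le hκ1 (by norm_num)
    rw [div_mul_eq_mul_div, le_div_iff₀ (by positivity)]
    calc (τ * ‖w x‖ ^ 2 + τ ^ 3 * ‖v x‖ ^ 2 + τ ^ 4 * A + τ ^ 2 * N) * (lam0 ^ 2 * κ ^ 4)
        = lam0 ^ 2 * (κ ^ 4 * (τ * ‖w x‖ ^ 2) + κ ^ 4 * (τ ^ 3 * ‖v x‖ ^ 2) +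
            κ ^ 4 * (τ ^ 4 * A) + κ ^ 4 * (τ ^ 2 * N)) := by ring
      _ ≤ lam0 ^ 2 * (κ * (τ * ‖w x‖ ^ 2) + κ ^ 3 * (τ ^ 3 * ‖v x‖ ^ 2) +
            κ ^ 4 * (τ ^ 4 * A) + κ ^ 2 * (τ ^ 2 * N)) := by gcongr
      _ = lam0 ^ 2 * (κ * τ * ‖w x‖ ^ 2 + (κ * τ) ^ 3 * ‖v x‖ ^ 2 + (κ * τ) ^ 4 * A +
            (κ * τ) ^ 2 * N) := by ring
      _ ≤ _ := hmain
      _ = 8 * (1 + 2 * q ^ 2) * (G + κ * (τ * ‖w y‖ ^ 2) + κ ^ 3 * (τ ^ 3 * ‖v y‖ ^ 2)) := by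
        ring
      _ ≤ 8 * (1 + 2 * q ^ 2) * (G + 1 * (τ * ‖w y‖ ^ 2) + 1 * (τ ^ 3 * ‖v y‖ ^ 2)) := by
        gcongr
      _ = _ := by ring
  · rw [normalSymbol_re]
    have h1 := (abs_le.1 (htγ t)).1
    have h2 : τ * (ρ * T) ≤ τ * κ := by gcongr
    have h3 : τ * c ≤ τ * (α + β * t) := by gcongr; exact (hφ t ht hts).1
    have h4 : c = 2 * κ := by rw [hκ]; ring
    rw [h4] at h3
    linarith
  · have h1 := (norm_normalSymbol_le a ξ γ τ s α β t)
    have h2 : |τ * (α + β * t)| ≤ τ * M := by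
      have h0 := hφ t ht hts
      rw [abs_of_nonneg (mul_nonneg hτ0.le (hc.le.trans h0.1))]
      gcongr
      exact h0.2
    have h3 : τ * (ρ * T) ≤ τ * T := by gcongr
    have h4 : q * (κ * τ) = τ * (2 * T + M) := by
      rw [hq]
      field_simp
    rw [h4]
    linarith [htγ t, htξ t]

theorem L2p_eq_intervalIntegral {F : ℝ → ℂ} {R : ℝ} (hR : 0 ≤ R) (hF : ∀ t, R < t → F t = 0) :
    L2p F = ∫ t in (0 : ℝ)..R, ‖F t‖ ^ 2 := by
  rw [L2p, intervalIntegral.integral_of_le hR]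
  refine setIntegral_eq_of_subset_of_forall_sdiff_eq_zero measurableSet_Ioi
    (fun t ht => ht.1) fun t ht => ?_
  have h0 : (0 : ℝ) < t := ht.1
  rw [hF t (not_le.1 fun h => ht.2 ⟨h0, h⟩)]
  simp

theorem L2m_eq_intervalIntegral {F : ℝ → ℂ} {R : ℝ} (hR : 0 ≤ R) (hF : ∀ t, t < -R → F t = 0) :
    L2m F = ∫ t in (-R)..0, ‖F t‖ ^ 2 := by
  rw [L2m, intervalIntegral.integral_of_le (by linarith), ← integral_Iic_eq_integral_Iio,
    integral_Icc_eq_integral_Ioc.symm]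
  refine setIntegral_eq_of_subset_of_forall_sdiff_eq_zero measurableSet_Iic
    (fun t ht => ht.2) fun t ht => ?_
  rw [hF t (not_le.1 fun h => ht.2 ⟨h, ht.1⟩)]
  simp

theorem Vval_eq_Pinner (a : ℝ → Matrix (Fin (m + 1)) (Fin (m + 1)) ℝ) (ξ γ : Em m)
    (τ s α β : ℝ) (v : ℝ → ℂ) : Vval a ξ γ τ s α v = Pinner a ξ γ τ s α β v 0 := by
  rw [Vval, Pinner, mul_zero, add_zero]
  ring

theorem Pinner_eq_zero (a : ℝ → Matrix (Fin (m + 1)) (Fin (m + 1)) ℝ) (ξ γ : Em m)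
    (τ s α β : ℝ) {v : ℝ → ℂ} {t : ℝ} (ht : t ∉ tsupport v) : Pinner a ξ γ τ s α β v t = 0 := by
  rw [Pinner, image_eq_zero_of_notMem_tsupport ht,
    Function.notMem_support.1 (fun h => ht (support_deriv_subset h))]
  simp

theorem Pop_eq_zero (a : ℝ → Matrix (Fin (m + 1)) (Fin (m + 1)) ℝ) (ξ γ : Em m)
    (τ s α β : ℝ) {v : ℝ → ℂ} {t : ℝ} (ht : t ∉ tsupport v) : Pop a ξ γ τ s α β v t = 0 := by
  have hsub : tsupport (Pinner a ξ γ τ s α β v) ⊆ tsupport v :=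
    closure_minimal (fun x hx => by_contra fun h => hx (Pinner_eq_zero a ξ γ τ s α β h))
      (isClosed_tsupport v)
  rw [Pop, image_eq_zero_of_notMem_tsupport ht, Pinner_eq_zero a ξ γ τ s α β ht,
    Function.notMem_support.1 (fun h => ht (hsub (support_deriv_subset h)))]
  simp

/-- Triangle inequality for squared norms in `ℂ`. -/
theorem norm_sq_le_two_mul_add (p q : ℂ) : ‖q‖ ^ 2 ≤ 2 * ‖p‖ ^ 2 + 2 * ‖p - q‖ ^ 2 := by
  have h1 : ‖q‖ ≤ ‖p‖ + ‖p - q‖ := by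
    calc ‖q‖ = ‖p - (p - q)‖ := by rw [sub_sub_cancel]
      _ ≤ _ := norm_sub_le _ _
  nlinarith [norm_nonneg q, pow_le_pow_left₀ (norm_nonneg _) h1 2, sq_nonneg (‖p‖ - ‖p - q‖)]

/-- Coupling of the two one-sided estimates through the transmission terms, with the weight `τ`
replaced by a comparable weight `Λ`. -/
theorem transmission_estimate {τ Λ K E Vp Vm wp wm Ap Am Np Nm Gp Gm H1 H0 : ℝ} (hτ0 : 0 < τ)
    (hΛτ : τ ≤ Λ) (hΛ2 : Λ ≤ 2 * τ) (hK : 0 < K) (hE : 0 ≤ E) (hVp : 0 ≤ Vp) (hVm : 0 ≤ Vm)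
    (hwp : 0 ≤ wp) (hwm : 0 ≤ wm) (hAp : 0 ≤ Ap) (hAm : 0 ≤ Am) (hNp : 0 ≤ Np) (hNm : 0 ≤ Nm)
    (hGp : 0 ≤ Gp) (hGm : 0 ≤ Gm) (hH1 : 0 ≤ H1) (hH0 : 0 ≤ H0)
    (hV : Vm ≤ 2 * Vp + 2 * H1) (hv0 : wm ≤ 2 * wp + 2 * H0)
    (estp : τ * Vp + τ ^ 3 * wp + τ ^ 4 * Ap + τ ^ 2 * Np ≤ K * Gp)
    (estm : τ ^ 4 * Am + τ ^ 2 * Nm ≤ K * (Gm + τ * Vm + τ ^ 3 * wm)) :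
    Λ * (Vp + Vm) + Λ ^ 3 * (wp + wm) + Λ ^ 4 * (Ap + Am) + Λ ^ 2 * (Np + Nm) ≤
      (E + 16 * (K + 2 * (K + 1) * (K + 1))) * (Gp + Gm) +
        (E + 16 * (K + 2 * (K + 1) * (K + 1))) * Λ * H1 +
        (E + 16 * (K + 2 * (K + 1) * (K + 1))) * Λ ^ 3 * H0 := by
  have hΛ0 : 0 < Λ := hτ0.trans_le hΛτ
  have h1 : τ * (Vp + Vm) + τ ^ 3 * (wp + wm) + τ ^ 4 * (Ap + Am) + τ ^ 2 * (Np + Nm) ≤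
      (K + 2 * (K + 1) * (K + 1)) * (Gp + Gm + τ * H1 + τ ^ 3 * H0) := by
    have hb : τ * Vm + τ ^ 3 * wm ≤ 2 * (K * Gp + τ * H1 + τ ^ 3 * H0) := by
      have h2 := mul_le_mul_of_nonneg_left hV hτ0.le
      have h3 := mul_le_mul_of_nonneg_left hv0 (pow_nonneg hτ0.le 3)
      have h4 : 0 ≤ τ ^ 4 * Ap := by positivity
      have h5 : 0 ≤ τ ^ 2 * Np := by positivity
      linarith
    have hb' := mul_le_mul_of_nonneg_left hb (by positivity : 0 ≤ K + 1)
    have hX : 0 ≤ K * (τ * H1 + τ ^ 3 * H0) := by positivity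
    have hX' : 0 ≤ K ^ 2 * (τ * H1 + τ ^ 3 * H0) := by positivity
    have hY : 0 ≤ 2 * (K + 1) * (K + 1) * Gm := by positivity
    have hY' : 0 ≤ K * Gp := by positivity
    linarith
  calc Λ * (Vp + Vm) + Λ ^ 3 * (wp + wm) + Λ ^ 4 * (Ap + Am) + Λ ^ 2 * (Np + Nm)
      ≤ (2 * τ) * (Vp + Vm) + (2 * τ) ^ 3 * (wp + wm) + (2 * τ) ^ 4 * (Ap + Am) +
          (2 * τ) ^ 2 * (Np + Nm) := by gcongr
    _ ≤ 16 * (τ * (Vp + Vm) + τ ^ 3 * (wp + wm) + τ ^ 4 * (Ap + Am) + τ ^ 2 * (Np + Nm)) := by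
        have g1 : 0 ≤ τ * (Vp + Vm) := by positivity
        have g2 : 0 ≤ τ ^ 3 * (wp + wm) := by positivity
        have g3 : 0 ≤ τ ^ 2 * (Np + Nm) := by positivity
        linarith
    _ ≤ 16 * ((K + 2 * (K + 1) * (K + 1)) * (Gp + Gm + τ * H1 + τ ^ 3 * H0)) := by gcongr
    _ ≤ 16 * ((K + 2 * (K + 1) * (K + 1)) * (Gp + Gm + Λ * H1 + Λ ^ 3 * H0)) := by gcongr
    _ = 16 * (K + 2 * (K + 1) * (K + 1)) * (Gp + Gm + Λ * H1 + Λ ^ 3 * H0) := by ring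
    _ ≤ (E + 16 * (K + 2 * (K + 1) * (K + 1))) * (Gp + Gm + Λ * H1 + Λ ^ 3 * H0) := by
        gcongr
        linarith
    _ = _ := by ring

/-- **Lemma 3.4.** In Case 1 (`τ ≥ λ₂²|ξ|/(2s₀)`), with the transmission terms `η₀, η₁`,
the two-sided estimate (3.75) holds, with `C` depending only on `λ₀, M₀, α₊, α₋, β`. -/
theorem statement5 (m : ℕ) (hm : 1 ≤ m) (lam0 M0 lam1 : ℝ)
    (hlam0 : 0 < lam0) (hlam0' : lam0 ≤ 1) (hM0 : 0 < M0)
    (hlam1 : 0 < lam1) (hlam1' : lam1 ≤ lam0) :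
    ∀ αp αm β : ℝ, 0 < αp → 0 < αm → 0 < β →
    ∃ C > 0, ∀ ap am : ℝ → Matrix (Fin (m + 1)) (Fin (m + 1)) ℝ,
      GoodCoeff lam0 M0 ap → GoodCoeff lam0 M0 am →
      GoodB lam1 ap → GoodB lam1 am →
      ∀ (γ ξ : Em m), ‖γ‖ ≤ 1 →
      ∀ τ s s0 : ℝ, 1 ≤ τ → 0 < s → s ≤ s0 → s0 < 1 → s0 ≤ 1 / C →
        lam0 * lam1 * ‖ξ‖ / (2 * s0) ≤ τ →
      ∀ vp vm : ℝ → ℂ,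
        ContDiff ℝ (⊤ : ℕ∞) vp → HasCompactSupport vp →
        ContDiff ℝ (⊤ : ℕ∞) vm → HasCompactSupport vm →
        Function.support vp ⊆ Set.Icc (-(min αm 1 / (2 * β))) (min αm 1 / β) →
        Function.support vm ⊆ Set.Icc (-(min αm 1 / (2 * β))) (min αm 1 / β) →
        Lam ξ τ * (‖Vval ap ξ γ τ s αp vp‖ ^ 2 + ‖Vval am ξ γ τ s αm vm‖ ^ 2) +
          (Lam ξ τ) ^ 3 * (‖vp 0‖ ^ 2 + ‖vm 0‖ ^ 2) +
          (Lam ξ τ) ^ 4 * (L2p vp + L2m vm) +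
          (Lam ξ τ) ^ 2 * (L2p (deriv vp) + L2m (deriv vm)) ≤
        C * (L2p (Pop ap ξ γ τ s αp β vp) + L2m (Pop am ξ γ τ s αm β vm)) +
          C * Lam ξ τ * ‖Vval ap ξ γ τ s αp vp - Vval am ξ γ τ s αm vm‖ ^ 2 +
          C * (Lam ξ τ) ^ 3 * ‖vp 0 - vm 0‖ ^ 2 := by
  intro αp αm β hαp hαm hβ
  set c : ℝ := min 1 (min αp (αm / 2)) with hc
  have hc0 : 0 < c := by positivity
  have hc1 : c ≤ 1 := min_le_left _ _
  have hcp : c ≤ αp := (min_le_right _ _).trans (min_le_left _ _)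
  have hcm : c ≤ αm / 2 := (min_le_right _ _).trans (min_le_right _ _)
  clear_value c
  obtain ⟨ρ, hρ0, hρ1, K, hK, hside⟩ :=
    exists_one_sided_estimate m M0 hlam0 hlam0' (αp + αm + 1) hc0 hc1
  set D : ℝ := 2 / (lam0 * lam1) + 1 with hD
  have hD1 : 1 ≤ D := by
    have : 0 ≤ 2 / (lam0 * lam1) := by positivity
    linarith
  have hD0 : 0 < D := by linarith
  refine ⟨D / ρ + 16 * (K + 2 * (K + 1) * (K + 1)), by positivity, ?_⟩
  intro ap am hap ham _ _ γ ξ hγ τ s s0 hτ hs hss0 _ hs0C hτξ vp vm hvp _ hvm _ hsp hsm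
  have hτ0 : 0 < τ := by linarith
  have hs0 : 0 < s0 := hs.trans_le hss0
  have hDs0 : D * s0 ≤ ρ := by
    rw [le_div_iff₀ (by positivity)] at hs0C
    have h1 : s0 * (D / ρ) ≤ 1 := by
      have : 0 ≤ s0 * (16 * (K + 2 * (K + 1) * (K + 1))) := by positivity
      linarith
    rw [← mul_div_assoc, div_le_one hρ0] at h1
    linarith
  have hsρ : s ≤ ρ := by
    have : 1 * s0 ≤ D * s0 := by gcongr
    linarith
  have hξ : ‖ξ‖ ≤ ρ * τ := by
    rw [div_le_iff₀ (by positivity)] at hτξ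
    have h1 : ‖ξ‖ ≤ τ * (2 * s0) / (lam0 * lam1) := by
      rw [le_div_iff₀ (by positivity)]
      linarith
    have h2 : τ * (2 * s0) / (lam0 * lam1) = (D * s0 - s0) * τ := by
      rw [hD]
      ring
    have h3 : (D * s0 - s0) * τ ≤ ρ * τ := by
      gcongr
      linarith
    linarith
  set c₀ : ℝ := min αm 1 with hc₀
  have hc₀0 : 0 < c₀ := by positivity
  have hc₀m : c₀ ≤ αm := min_le_left _ _
  have hc₀1 : c₀ ≤ 1 := min_le_right _ _
  set R : ℝ := c₀ / β + 1 with hR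
  have hR0 : 0 ≤ R := by positivity
  have hRm : c₀ / (2 * β) < R := by
    have h1 : c₀ / (2 * β) ≤ c₀ / β := by
      gcongr
      linarith
    linarith
  have htp : tsupport vp ⊆ Set.Icc (-(c₀ / (2 * β))) (c₀ / β) := closure_minimal hsp isClosed_Icc
  have htm : tsupport vm ⊆ Set.Icc (-(c₀ / (2 * β))) (c₀ / β) := closure_minimal hsm isClosed_Icc
  have hoff_p : ∀ t, R ≤ t → t ∉ tsupport vp := fun t ht h => by
    have := (htp h).2
    linarith
  have hoff_m : ∀ t, t ≤ -R → t ∉ tsupport vm := fun t ht h => by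
    have := (htm h).1
    linarith
  have estp := hside ap hap γ ξ hγ τ s αp β hτ hs hsρ hξ vp (contDiff_infty.1 hvp 2)
    0 R hR0 fun t ht hts => by
      have h1 : 0 ≤ β * t := mul_nonneg hβ.le ht.1.le
      have h2 : β * t ≤ c₀ := by
        have := (htp hts).2
        rwa [le_div_iff₀ hβ, mul_comm] at this
      constructor <;> linarith
  have estm := hside am ham γ ξ hγ τ s αm β hτ hs hsρ hξ vm (contDiff_infty.1 hvm 2)
    (-R) 0 (by linarith) fun t ht hts => by
      have h1 : β * t ≤ 0 := mul_nonpos_of_nonneg_of_nonpos hβ.le ht.2.le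
      have h2 : -(c₀ / 2) ≤ β * t := by
        have h3 : -(c₀ / (2 * β)) * β ≤ t * β :=
          mul_le_mul_of_nonneg_right (htm hts).1 hβ.le
        have h4 : -(c₀ / (2 * β)) * β = -(c₀ / 2) := by field_simp
        linarith
      constructor <;> linarith
  rw [Pinner_eq_zero ap ξ γ τ s αp β (hoff_p R le_rfl),
    image_eq_zero_of_notMem_tsupport (hoff_p R le_rfl), ← Vval_eq_Pinner,
    ← L2p_eq_intervalIntegral hR0 fun t ht => image_eq_zero_of_notMem_tsupport (hoff_p t ht.le),
    ← L2p_eq_intervalIntegral hR0 fun t ht => Function.notMem_support.1 fun h =>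
      hoff_p t ht.le (support_deriv_subset h),
    ← L2p_eq_intervalIntegral hR0 fun t ht => Pop_eq_zero ap ξ γ τ s αp β (hoff_p t ht.le)] at estp
  rw [Pinner_eq_zero am ξ γ τ s αm β (hoff_m (-R) le_rfl),
    image_eq_zero_of_notMem_tsupport (hoff_m (-R) le_rfl), ← Vval_eq_Pinner,
    ← L2m_eq_intervalIntegral hR0 fun t ht => image_eq_zero_of_notMem_tsupport (hoff_m t ht.le),
    ← L2m_eq_intervalIntegral hR0 fun t ht => Function.notMem_support.1 fun h =>
      hoff_m t ht.le (support_deriv_subset h),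
    ← L2m_eq_intervalIntegral hR0 fun t ht => Pop_eq_zero am ξ γ τ s αm β (hoff_m t ht.le)] at estm
  simp only [norm_zero, ne_eq, OfNat.ofNat_ne_zero, not_false_eq_true, zero_pow, mul_zero,
    add_zero, zero_add] at estp estm
  have hL2p : ∀ F : ℝ → ℂ, 0 ≤ L2p F := fun F => integral_nonneg fun t => by positivity
  have hL2m : ∀ F : ℝ → ℂ, 0 ≤ L2m F := fun F => integral_nonneg fun t => by positivity
  have hΛτ : τ ≤ Lam ξ τ := Real.le_sqrt_of_sq_le (by nlinarith [sq_nonneg ‖ξ‖])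
  have hΛ2 : Lam ξ τ ≤ 2 * τ := by
    have hξτ : ‖ξ‖ ≤ τ := hξ.trans (mul_le_of_le_one_left hτ0.le hρ1)
    refine Real.sqrt_le_iff.2 ⟨by positivity, ?_⟩
    nlinarith [norm_nonneg ξ]
  exact transmission_estimate hτ0 hΛτ hΛ2 hK (by positivity) (sq_nonneg _) (sq_nonneg _)
    (sq_nonneg _) (sq_nonneg _) (hL2p _) (hL2m _) (hL2p _) (hL2m _) (hL2p _) (hL2m _)
    (sq_nonneg _) (sq_nonneg _) (norm_sq_le_two_mul_add _ _) (norm_sq_le_two_mul_add _ _) estp estm
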